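/- The intuitionistic modal logic iS4, defined as the smallest set of L(□)-formulas containing all theorems of IPC, the axioms □(p∧q) ↔ (□p ∧ □q), □⊤, □p → p, and □p → □□p, and closed under uniform substitution, modus ponens, and necessitation, has the Craig interpolation property. -/

import Mathlib

/-- Formulas of the language L(□). -/
inductive Fml0 : Type
  | var : ℕ → Fml0
  | top : Fml0
  | bot : Fml0
  | and : Fml0 → Fml0 → Fml0
  | or : Fml0 → Fml0 → Fml0
  | imp : Fml0 → Fml0 → Fml0
  | box : Fml0 → Fml0

/-- Biconditional, as an abbreviation. -/
def Fml0.iff (φ ψ : Fml0) : Fml0 := (φ.imp ψ).and (ψ.imp φ)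

/-- Uniform substitution. -/
def Fml0.subst (σ : ℕ → Fml0) : Fml0 → Fml0
  | .var n => σ n
  | .top => .top
  | .bot => .bot
  | .and φ ψ => .and (φ.subst σ) (ψ.subst σ)
  | .or φ ψ => .or (φ.subst σ) (ψ.subst σ)
  | .imp φ ψ => .imp (φ.subst σ) (ψ.subst σ)
  | .box φ => .box (φ.subst σ)

/-- The set of propositional variables occurring in a formula. -/
def Fml0.vars : Fml0 → Set ℕ
  | .var n => {n}
  | .top => ∅
  | .bot => ∅
  | .and φ ψ => φ.vars ∪ ψ.vars
  | .or φ ψ => φ.vars ∪ ψ.vars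
  | .imp φ ψ => φ.vars ∪ ψ.vars
  | .box φ => φ.vars

/-- Theorems of the intuitionistic propositional calculus (in the language
L(□)), given by a standard Hilbert-style axiomatization; the axiom schemes
range over all formulas, so the set is closed under substitution. -/
inductive IPC0 : Fml0 → Prop
  | ax1 (φ ψ : Fml0) : IPC0 (φ.imp (ψ.imp φ))
  | ax2 (φ ψ χ : Fml0) : IPC0 ((φ.imp (ψ.imp χ)).imp ((φ.imp ψ).imp (φ.imp χ)))
  | andE1 (φ ψ : Fml0) : IPC0 ((φ.and ψ).imp φ)
  | andE2 (φ ψ : Fml0) : IPC0 ((φ.and ψ).imp ψ)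
  | andI (φ ψ : Fml0) : IPC0 (φ.imp (ψ.imp (φ.and ψ)))
  | orI1 (φ ψ : Fml0) : IPC0 (φ.imp (φ.or ψ))
  | orI2 (φ ψ : Fml0) : IPC0 (ψ.imp (φ.or ψ))
  | orE (φ ψ χ : Fml0) : IPC0 ((φ.imp χ).imp ((ψ.imp χ).imp ((φ.or ψ).imp χ)))
  | botE (φ : Fml0) : IPC0 (Fml0.bot.imp φ)
  | topI : IPC0 Fml0.top
  | mp (φ ψ : Fml0) : IPC0 (φ.imp ψ) → IPC0 φ → IPC0 ψ

/-- `BoxLogic Ax L`: L contains all theorems of IPC, the normality axioms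
□(p∧q) ↔ (□p ∧ □q) and □⊤, and the extra axioms Ax, and is closed under
uniform substitution, modus ponens and necessitation. -/
structure BoxLogic (Ax : Set Fml0) (L : Set Fml0) : Prop where
  ipc : ∀ φ : Fml0, IPC0 φ → φ ∈ L
  norm_and : Fml0.iff (((Fml0.var 0).and (Fml0.var 1)).box)
    (((Fml0.var 0).box).and ((Fml0.var 1).box)) ∈ L
  norm_top : Fml0.top.box ∈ L
  ax : Ax ⊆ L
  subst : ∀ φ ∈ L, ∀ σ : ℕ → Fml0, φ.subst σ ∈ L
  mp : ∀ φ ψ : Fml0, φ.imp ψ ∈ L → φ ∈ L → ψ ∈ L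
  nec : ∀ φ ∈ L, φ.box ∈ L

/-- The smallest logic in the language L(□) with the given extra axioms. -/
def smallestBoxLogic (Ax : Set Fml0) : Set Fml0 :=
  {φ | ∀ L : Set Fml0, BoxLogic Ax L → φ ∈ L}

/-- The T axiom □p → p. -/
def axT0 : Fml0 := ((Fml0.var 0).box).imp (Fml0.var 0)

/-- The 4 axiom □p → □□p. -/
def axFour0 : Fml0 := ((Fml0.var 0).box).imp ((Fml0.var 0).box.box)

/-- The Craig interpolation property for sets of L(□)-formulas. -/
def CIP0 (L : Set Fml0) : Prop :=
  ∀ φ ψ : Fml0, φ.imp ψ ∈ L →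
    ∃ χ : Fml0, χ.vars ⊆ φ.vars ∩ ψ.vars ∧ φ.imp χ ∈ L ∧ χ.imp ψ ∈ L


/-! ### The smallest logic with given axioms -/

theorem smallestBoxLogic_isBoxLogic (Ax : Set Fml0) : BoxLogic Ax (smallestBoxLogic Ax) where
  ipc φ h _ hL := hL.ipc φ h
  norm_and _ hL := hL.norm_and
  norm_top _ hL := hL.norm_top
  ax _ h _ hL := hL.ax h
  subst φ h σ L hL := hL.subst φ (h L hL) σ
  mp φ ψ h h' L hL := hL.mp φ ψ (h L hL) (h' L hL)
  nec φ h L hL := hL.nec φ (h L hL)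

theorem Fml0.subst_subst (σ τ : ℕ → Fml0) (φ : Fml0) :
    (φ.subst σ).subst τ = φ.subst (fun n => (σ n).subst τ) := by
  induction φ <;> simp_all [Fml0.subst]

/-- The logic iS4. -/
abbrev iS4 : Set Fml0 := smallestBoxLogic {axT0, axFour0}

theorem iS4_isBoxLogic : BoxLogic {axT0, axFour0} iS4 := smallestBoxLogic_isBoxLogic _

theorem iS4_axT (A : Fml0) : A.box.imp A ∈ iS4 :=
  iS4_isBoxLogic.subst axT0 (iS4_isBoxLogic.ax (by simp)) (fun _ => A)

theorem iS4_axFour (A : Fml0) : A.box.imp A.box.box ∈ iS4 :=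
  iS4_isBoxLogic.subst axFour0 (iS4_isBoxLogic.ax (by simp)) (fun _ => A)

theorem iS4_box_and (A B : Fml0) :
    ((A.and B).box.iff (A.box.and B.box)) ∈ iS4 :=
  iS4_isBoxLogic.subst _ iS4_isBoxLogic.norm_and (fun n => if n = 0 then A else B)

/-! ### Deductions in iS4 from hypotheses -/

/-- `Ded Γ A`: the formula `A` is deducible from `Γ` and theorems of iS4 by modus ponens. -/
inductive Ded (Γ : Set Fml0) : Fml0 → Prop
  | thm {A : Fml0} : A ∈ iS4 → Ded Γ A
  | hyp {A : Fml0} : A ∈ Γ → Ded Γ A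
  | mp {A B : Fml0} : Ded Γ (A.imp B) → Ded Γ A → Ded Γ B

namespace Ded

variable {Γ Δ : Set Fml0} {A B C : Fml0}

theorem ipc (h : IPC0 A) : Ded Γ A := thm (iS4_isBoxLogic.ipc A h)

theorem trans (h : Ded Γ A) (hΓ : ∀ B ∈ Γ, Ded Δ B) : Ded Δ A := by
  induction h with
  | thm h => exact thm h
  | hyp h => exact hΓ _ h
  | mp _ _ ih₁ ih₂ => exact mp ih₁ ih₂

theorem mono (h : Ded Γ A) (hΓ : Γ ⊆ Δ) : Ded Δ A := h.trans fun _ hB => hyp (hΓ hB)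

theorem impI (h : Ded (insert A Γ) B) : Ded Γ (A.imp B) := by
  induction h with
  | thm h => exact mp (ipc (.ax1 _ _)) (thm h)
  | @hyp C h =>
    rcases h with rfl | h
    · exact mp (mp (ipc (.ax2 _ (C.imp C) _)) (ipc (.ax1 _ _))) (ipc (.ax1 _ _))
    · exact mp (ipc (.ax1 _ _)) (hyp h)
  | mp _ _ ih₁ ih₂ => exact mp (mp (ipc (.ax2 _ _ _)) ih₁) ih₂

theorem cut (h : Ded Γ A) (h' : Ded (insert A Γ) B) : Ded Γ B := mp (impI h') h

theorem andI (h : Ded Γ A) (h' : Ded Γ B) : Ded Γ (A.and B) := mp (mp (ipc (.andI _ _)) h) h'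

theorem andE1 (h : Ded Γ (A.and B)) : Ded Γ A := mp (ipc (.andE1 _ _)) h

theorem andE2 (h : Ded Γ (A.and B)) : Ded Γ B := mp (ipc (.andE2 _ _)) h

theorem orI1 (h : Ded Γ A) : Ded Γ (A.or B) := mp (ipc (.orI1 _ _)) h

theorem orI2 (h : Ded Γ B) : Ded Γ (A.or B) := mp (ipc (.orI2 _ _)) h

theorem orE (h : Ded Γ (A.or B)) (h₁ : Ded (insert A Γ) C) (h₂ : Ded (insert B Γ) C) : Ded Γ C :=
  mp (mp (mp (ipc (.orE _ _ _)) (impI h₁)) (impI h₂)) h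

theorem botE (h : Ded Γ .bot) : Ded Γ A := mp (ipc (.botE _)) h

theorem topI : Ded Γ .top := ipc .topI

theorem boxE (h : Ded Γ A.box) : Ded Γ A := mp (thm (iS4_axT A)) h

theorem mem_iS4 (h : Ded ∅ A) : A ∈ iS4 := by
  induction h with
  | thm h => exact h
  | hyp h => exact h.elim
  | mp _ _ ih₁ ih₂ => exact iS4_isBoxLogic.mp _ _ ih₁ ih₂

theorem boxAndI (h : Ded Γ A.box) (h' : Ded Γ B.box) : Ded Γ (A.and B).box :=
  mp (andE2 (thm (iS4_box_and A B))) (andI h h')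

theorem boxAndE (h : Ded Γ (A.and B).box) : Ded Γ (A.box.and B.box) :=
  mp (andE1 (thm (iS4_box_and A B))) h

theorem boxFour (h : Ded Γ A.box) : Ded Γ A.box.box := mp (thm (iS4_axFour A)) h

end Ded

/-! ### A cut-free sequent calculus

The logic has necessitation, but its box need not respect provable equivalence, so the right
rules for the box go by the shape of the boxed formula. -/

/-- Cut-free derivability of a sequent. -/
inductive Der : Set Fml0 → Fml0 → Prop
  | ax {Γ : Set Fml0} {n : ℕ} : .var n ∈ Γ → Der Γ (.var n)
  | botL {Γ : Set Fml0} {C : Fml0} : .bot ∈ Γ → Der Γ C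
  | topR {Γ : Set Fml0} : Der Γ .top
  | andR {Γ : Set Fml0} {A B : Fml0} : Der Γ A → Der Γ B → Der Γ (A.and B)
  | andL {Γ : Set Fml0} {A B C : Fml0} :
      A.and B ∈ Γ → Der (insert A (insert B Γ)) C → Der Γ C
  | orR1 {Γ : Set Fml0} {A B : Fml0} : Der Γ A → Der Γ (A.or B)
  | orR2 {Γ : Set Fml0} {A B : Fml0} : Der Γ B → Der Γ (A.or B)
  | orL {Γ : Set Fml0} {A B C : Fml0} :
      A.or B ∈ Γ → Der (insert A Γ) C → Der (insert B Γ) C → Der Γ C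
  | impR {Γ : Set Fml0} {A B : Fml0} : Der (insert A Γ) B → Der Γ (A.imp B)
  | impL {Γ : Set Fml0} {A B C : Fml0} :
      A.imp B ∈ Γ → Der Γ A → Der (insert B Γ) C → Der Γ C
  | boxL {Γ : Set Fml0} {A C : Fml0} : A.box ∈ Γ → Der (insert A Γ) C → Der Γ C
  | boxAndL {Γ : Set Fml0} {A B C : Fml0} :
      (A.and B).box ∈ Γ → Der (insert A.box (insert B.box Γ)) C → Der Γ C
  | boxAx {Γ : Set Fml0} {A : Fml0} : A.box ∈ Γ → Der Γ A.box
  | boxAndR {Γ : Set Fml0} {A B : Fml0} : Der Γ A.box → Der Γ B.box → Der Γ (A.and B).box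
  | boxBoxR {Γ : Set Fml0} {A : Fml0} : Der Γ A.box → Der Γ A.box.box
  | nec {Γ : Set Fml0} {A : Fml0} : Der ∅ A → Der Γ A.box

theorem Der.mono {Γ Δ : Set Fml0} {C : Fml0} (h : Der Γ C) (hΓ : Γ ⊆ Δ) : Der Δ C := by
  induction h generalizing Δ with
  | ax h => exact ax (hΓ h)
  | botL h => exact botL (hΓ h)
  | topR => exact topR
  | andR _ _ ih₁ ih₂ => exact andR (ih₁ hΓ) (ih₂ hΓ)
  | andL h _ ih => exact andL (hΓ h) (ih (Set.insert_subset_insert (Set.insert_subset_insert hΓ)))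
  | orR1 _ ih => exact orR1 (ih hΓ)
  | orR2 _ ih => exact orR2 (ih hΓ)
  | orL h _ _ ih₁ ih₂ =>
    exact orL (hΓ h) (ih₁ (Set.insert_subset_insert hΓ)) (ih₂ (Set.insert_subset_insert hΓ))
  | impR _ ih => exact impR (ih (Set.insert_subset_insert hΓ))
  | impL h _ _ ih₁ ih₂ => exact impL (hΓ h) (ih₁ hΓ) (ih₂ (Set.insert_subset_insert hΓ))
  | boxL h _ ih => exact boxL (hΓ h) (ih (Set.insert_subset_insert hΓ))
  | boxAndL h _ ih =>
    exact boxAndL (hΓ h) (ih (Set.insert_subset_insert (Set.insert_subset_insert hΓ)))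
  | boxAx h => exact boxAx (hΓ h)
  | boxAndR _ _ ih₁ ih₂ => exact boxAndR (ih₁ hΓ) (ih₂ hΓ)
  | boxBoxR _ ih => exact boxBoxR (ih hΓ)
  | nec h _ => exact nec h

theorem Der.ded {Γ : Set Fml0} {C : Fml0} (h : Der Γ C) : Ded Γ C := by
  induction h with
  | ax h => exact .hyp h
  | botL h => exact .botE (.hyp h)
  | topR => exact .topI
  | andR _ _ ih₁ ih₂ => exact .andI ih₁ ih₂
  | andL h _ ih =>
    refine ih.trans ?_
    rintro D (rfl | rfl | hD)
    exacts [.andE1 (.hyp h), .andE2 (.hyp h), .hyp hD]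
  | orR1 _ ih => exact .orI1 ih
  | orR2 _ ih => exact .orI2 ih
  | orL h _ _ ih₁ ih₂ => exact .orE (.hyp h) ih₁ ih₂
  | impR _ ih => exact .impI ih
  | impL h _ _ ih₁ ih₂ => exact .cut (.mp (.hyp h) ih₁) ih₂
  | boxL h _ ih => exact .cut (.boxE (.hyp h)) ih
  | boxAndL h _ ih =>
    have h' := Ded.boxAndE (.hyp h)
    refine ih.trans ?_
    rintro D (rfl | rfl | hD)
    exacts [.andE1 h', .andE2 h', .hyp hD]
  | boxAx h => exact .hyp h
  | boxAndR _ _ ih₁ ih₂ => exact .boxAndI ih₁ ih₂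
  | boxBoxR _ ih => exact .boxFour ih
  | nec _ ih => exact .thm (iS4_isBoxLogic.nec _ ih.mem_iS4)

/-! ### Semantics over contexts, and completeness of the cut-free calculus -/

/-- The closure of a set of contexts under case distinctions that the calculus can make. -/
def covered (P : Set Fml0 → Prop) (Γ : Set Fml0) : Prop :=
  ∀ Δ C, Γ ⊆ Δ → (∀ Θ, Δ ⊆ Θ → P Θ → Der Θ C) → Der Δ C

/-- `X` is a possible truth set of the formula `A`. -/
structure IsTruthSet (A : Fml0) (X : Set Fml0 → Prop) : Prop where
  mono : ∀ Γ Δ, Γ ⊆ Δ → X Γ → X Δ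
  closed : ∀ Γ, covered X Γ → X Γ
  reflect : ∀ Γ, A ∈ Γ → X Γ
  reify : ∀ Γ, X Γ → Der Γ A

theorem covered_mono (P : Set Fml0 → Prop) (Γ Δ : Set Fml0) (h : Γ ⊆ Δ) (hΓ : covered P Γ) :
    covered P Δ := fun Θ C hΘ => hΓ Θ C (h.trans hΘ)

theorem covered_closed (P : Set Fml0 → Prop) (Γ : Set Fml0) (h : covered (covered P) Γ) :
    covered P Γ :=
  fun Δ C hΔ hP => h Δ C hΔ fun Θ hΘ hcov => hcov Θ C subset_rfl fun Ξ hΞ => hP Ξ (hΘ.trans hΞ)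

theorem covered_imp {P Q : Set Fml0 → Prop} (hPQ : ∀ Γ, P Γ → Q Γ) {Γ : Set Fml0}
    (h : covered P Γ) : covered Q Γ :=
  fun Δ C hΔ hQ => h Δ C hΔ fun Θ hΘ hP => hQ Θ hΘ (hPQ Θ hP)

/-- The truth set of `□A` for `A` neither a conjunction nor boxed, given the truth set of `A`. -/
def boxTruth (A : Fml0) (X : Set Fml0 → Prop) : Set Fml0 → Prop :=
  covered fun Γ => A.box ∈ Γ ∨ X ∅

/-- The truth sets of `A` and of `□A`. -/
def Fml0.truth : Fml0 → (Set Fml0 → Prop) × (Set Fml0 → Prop)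
  | .var n => (fun Γ => Der Γ (.var n), boxTruth (.var n) fun Γ => Der Γ (.var n))
  | .top => (fun _ => True, boxTruth .top fun _ => True)
  | .bot => (covered fun _ => False, boxTruth .bot (covered fun _ => False))
  | .and A B => (fun Γ => A.truth.1 Γ ∧ B.truth.1 Γ, fun Γ => A.truth.2 Γ ∧ B.truth.2 Γ)
  | .or A B => (covered fun Γ => A.truth.1 Γ ∨ B.truth.1 Γ,
      boxTruth (.or A B) (covered fun Γ => A.truth.1 Γ ∨ B.truth.1 Γ))
  | .imp A B => (fun Γ => ∀ Δ, Γ ⊆ Δ → A.truth.1 Δ → B.truth.1 Δ,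
      boxTruth (.imp A B) fun Γ => ∀ Δ, Γ ⊆ Δ → A.truth.1 Δ → B.truth.1 Δ)
  | .box A => (A.truth.2, A.truth.2)

/-- The relation between the truth sets of `A` and of `□A`. -/
structure IsTruthPair (A : Fml0) (X Y : Set Fml0 → Prop) : Prop where
  self : IsTruthSet A X
  box : IsTruthSet A.box Y
  boxE : ∀ Γ, Y Γ → X Γ
  nec : (∀ Γ, X Γ) → ∀ Γ, Y Γ

theorem IsTruthSet.isTruthPair {A : Fml0} {X : Set Fml0 → Prop} (h : IsTruthSet A X) :
    IsTruthPair A X (boxTruth A X) where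
  self := h
  box :=
    { mono := covered_mono _
      closed := covered_closed _
      reflect := fun Γ hA Δ C hΔ hP => hP Δ subset_rfl (.inl (hΔ hA))
      reify := fun Γ hΓ => hΓ Γ _ subset_rfl fun Θ _ hΘ => by
        rcases hΘ with hΘ | hΘ
        · exact .boxAx hΘ
        · exact .nec (h.reify _ hΘ) }
  boxE Γ hΓ := by
    refine h.closed _ fun Δ C hΔ hX => hΓ Δ C hΔ fun Θ hΘ hP => ?_
    rcases hP with hP | hP
    · exact .boxL hP (hX _ (hΘ.trans (Set.subset_insert _ _)) (h.reflect _ (by simp)))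
    · exact hX _ hΘ (h.mono _ _ (Set.empty_subset _) hP)
  nec hX Γ Δ C hΔ hP := hP Δ subset_rfl (.inr (hX _))

theorem isTruthSet_and {A B : Fml0} {X Y : Set Fml0 → Prop} (hA : IsTruthSet A X)
    (hB : IsTruthSet B Y) : IsTruthSet (A.and B) fun Γ => X Γ ∧ Y Γ where
  mono Γ Δ h hΓ := ⟨hA.mono _ _ h hΓ.1, hB.mono _ _ h hΓ.2⟩
  closed Γ h := ⟨hA.closed _ (covered_imp (fun _ => And.left) h),
    hB.closed _ (covered_imp (fun _ => And.right) h)⟩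
  reflect Γ h :=
    ⟨hA.closed _ fun Δ C hΔ hX => .andL (hΔ h)
      (hX _ (fun _ hD => .inr (.inr hD)) (hA.reflect _ (by simp))),
    hB.closed _ fun Δ C hΔ hX => .andL (hΔ h)
      (hX _ (fun _ hD => .inr (.inr hD)) (hB.reflect _ (by simp)))⟩
  reify Γ h := .andR (hA.reify _ h.1) (hB.reify _ h.2)

theorem isTruthSet_box_and {A B : Fml0} {X Y : Set Fml0 → Prop} (hA : IsTruthSet A.box X)
    (hB : IsTruthSet B.box Y) : IsTruthSet (A.and B).box fun Γ => X Γ ∧ Y Γ where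
  mono := (isTruthSet_and hA hB).mono
  closed := (isTruthSet_and hA hB).closed
  reflect Γ h :=
    ⟨hA.closed _ fun Δ C hΔ hX => .boxAndL (hΔ h)
      (hX _ (fun _ hD => .inr (.inr hD)) (hA.reflect _ (by simp))),
    hB.closed _ fun Δ C hΔ hX => .boxAndL (hΔ h)
      (hX _ (fun _ hD => .inr (.inr hD)) (hB.reflect _ (by simp)))⟩
  reify Γ h := .boxAndR (hA.reify _ h.1) (hB.reify _ h.2)

theorem isTruthSet_or {A B : Fml0} {X Y : Set Fml0 → Prop} (hA : IsTruthSet A X)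
    (hB : IsTruthSet B Y) : IsTruthSet (A.or B) (covered fun Γ => X Γ ∨ Y Γ) where
  mono := covered_mono _
  closed := covered_closed _
  reflect Γ h Δ C hΔ hP := .orL (hΔ h)
    (hP _ (Set.subset_insert _ _) (.inl (hA.reflect _ (by simp))))
    (hP _ (Set.subset_insert _ _) (.inr (hB.reflect _ (by simp))))
  reify Γ h := h Γ _ subset_rfl fun Θ _ hΘ => by
    rcases hΘ with hΘ | hΘ
    · exact .orR1 (hA.reify _ hΘ)
    · exact .orR2 (hB.reify _ hΘ)

theorem isTruthSet_imp {A B : Fml0} {X Y : Set Fml0 → Prop} (hA : IsTruthSet A X)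
    (hB : IsTruthSet B Y) : IsTruthSet (A.imp B) fun Γ => ∀ Δ, Γ ⊆ Δ → X Δ → Y Δ where
  mono Γ Δ h hΓ Θ hΘ := hΓ Θ (h.trans hΘ)
  closed Γ h Δ hΔ hX := hB.closed _ fun Δ' C hΔ' hY => h Δ' C (hΔ.trans hΔ') fun Θ hΘ hΘ' =>
    hY Θ hΘ (hΘ' Θ subset_rfl (hA.mono _ _ (hΔ'.trans hΘ) hX))
  reflect Γ h Δ hΔ hX := hB.closed _ fun Δ' C hΔ' hY =>
    .impL (hΔ' (hΔ h)) ((hA.reify _ hX).mono hΔ')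
      (hY _ (Set.subset_insert _ _) (hB.reflect _ (by simp)))
  reify Γ h := .impR (hB.reify _ (h _ (Set.subset_insert _ _) (hA.reflect _ (by simp))))

theorem isTruthSet_box_box {A : Fml0} {Y : Set Fml0 → Prop} (h : IsTruthSet A.box Y) :
    IsTruthSet A.box.box Y where
  mono := h.mono
  closed := h.closed
  reflect Γ hΓ := h.closed _ fun Δ C hΔ hY => .boxL (hΔ hΓ)
    (hY _ (Set.subset_insert _ _) (h.reflect _ (by simp)))
  reify Γ hΓ := .boxBoxR (h.reify _ hΓ)

theorem Fml0.isTruthPair (A : Fml0) : IsTruthPair A A.truth.1 A.truth.2 := by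
  induction A with
  | var n =>
    refine IsTruthSet.isTruthPair ⟨fun _ _ h hΓ => hΓ.mono h, fun Γ h => ?_, fun _ => .ax,
      fun _ => id⟩
    exact h Γ _ subset_rfl fun _ _ => id
  | top =>
    exact IsTruthSet.isTruthPair ⟨fun _ _ _ _ => trivial, fun _ _ => trivial,
      fun _ _ => trivial, fun _ _ => .topR⟩
  | bot =>
    exact IsTruthSet.isTruthPair ⟨covered_mono _, covered_closed _,
      fun _ h _ _ hΔ _ => .botL (hΔ h), fun Γ h => h Γ _ subset_rfl fun _ _ => False.elim⟩
  | and A B ihA ihB =>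
    exact ⟨isTruthSet_and ihA.self ihB.self, isTruthSet_box_and ihA.box ihB.box,
      fun Γ h => ⟨ihA.boxE Γ h.1, ihB.boxE Γ h.2⟩,
      fun h Γ => ⟨ihA.nec (fun Δ => (h Δ).1) Γ, ihB.nec (fun Δ => (h Δ).2) Γ⟩⟩
  | or A B ihA ihB => exact (isTruthSet_or ihA.self ihB.self).isTruthPair
  | imp A B ihA ihB => exact (isTruthSet_imp ihA.self ihB.self).isTruthPair
  | box A ih => exact ⟨ih.box, isTruthSet_box_box ih.box, fun _ => id, id⟩

theorem IPC0.truth {A : Fml0} (h : IPC0 A) (σ : ℕ → Fml0) (Γ : Set Fml0) :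
    (A.subst σ).truth.1 Γ := by
  induction h generalizing Γ with
  | ax1 A B =>
    exact fun Δ _ hA Θ hΘ _ => (A.subst σ).isTruthPair.self.mono _ _ hΘ hA
  | ax2 A B C =>
    exact fun Δ _ h₁ Θ hΘ h₂ Ξ hΞ h₃ => h₁ Ξ (hΘ.trans hΞ) h₃ Ξ subset_rfl (h₂ Ξ hΞ h₃)
  | andE1 A B => exact fun Δ _ h => h.1
  | andE2 A B => exact fun Δ _ h => h.2
  | andI A B =>
    exact fun Δ _ hA Θ hΘ hB => ⟨(A.subst σ).isTruthPair.self.mono _ _ hΘ hA, hB⟩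
  | orI1 A B =>
    exact fun Δ _ hA Θ C hΘ hP =>
      hP Θ subset_rfl (.inl ((A.subst σ).isTruthPair.self.mono _ _ hΘ hA))
  | orI2 A B =>
    exact fun Δ _ hB Θ C hΘ hP =>
      hP Θ subset_rfl (.inr ((B.subst σ).isTruthPair.self.mono _ _ hΘ hB))
  | orE A B C =>
    intro Δ _ h₁ Θ hΘ h₂ Ξ hΞ h₃
    refine (C.subst σ).isTruthPair.self.closed _ fun Δ' D hΔ' hC =>
      h₃ Δ' D hΔ' fun Θ' hΘ' hP => hC Θ' hΘ' ?_
    rcases hP with hP | hP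
    · exact h₁ Θ' (hΘ.trans (hΞ.trans (hΔ'.trans hΘ'))) hP
    · exact h₂ Θ' (hΞ.trans (hΔ'.trans hΘ')) hP
  | botE A =>
    exact fun Δ _ h => (A.subst σ).isTruthPair.self.closed _
      (covered_imp (fun _ => False.elim) h)
  | topI => trivial
  | mp A B _ _ ih₁ ih₂ => exact ih₁ Γ Γ subset_rfl (ih₂ Γ)

theorem isBoxLogic_true :
    BoxLogic {axT0, axFour0} {A | ∀ σ Γ, (A.subst σ).truth.1 Γ} where
  ipc A h := h.truth
  norm_and σ Γ := ⟨fun _ _ => id, fun _ _ => id⟩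
  norm_top σ Γ := Fml0.top.isTruthPair.nec (fun _ => trivial) Γ
  ax := by
    rintro A (rfl | rfl) σ Γ
    · exact fun Δ _ => (σ 0).isTruthPair.boxE Δ
    · exact fun Δ _ => id
  subst A h σ τ := by
    rw [Fml0.subst_subst]
    exact h _
  mp A B h₁ h₂ σ Γ := h₁ σ Γ Γ subset_rfl (h₂ σ Γ)
  nec A h σ := (A.subst σ).isTruthPair.nec (h σ)

theorem Fml0.subst_var (A : Fml0) : A.subst .var = A := by
  induction A <;> simp_all [Fml0.subst]

theorem der_of_imp_mem_iS4 {A B : Fml0} (h : A.imp B ∈ iS4) : Der {A} B := by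
  have hAB := h _ isBoxLogic_true .var {A}
  rw [Fml0.subst_var] at hAB
  exact B.isTruthPair.self.reify _
    (hAB _ subset_rfl (A.isTruthPair.self.reflect _ (Set.mem_singleton A)))

/-! ### Interpolation for the cut-free calculus -/

/-- The variables occurring in a set of formulas. -/
def ctxVars (Γ : Set Fml0) : Set ℕ := ⋃ A ∈ Γ, A.vars

theorem ctxVars_insert (A : Fml0) (Γ : Set Fml0) : ctxVars (insert A Γ) = A.vars ∪ ctxVars Γ :=
  Set.biUnion_insert _ _ _

theorem vars_subset_ctxVars {A : Fml0} {Γ : Set Fml0} (h : A ∈ Γ) : A.vars ⊆ ctxVars Γ :=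
  Set.subset_biUnion_of_mem (u := Fml0.vars) h

/-- `X` interpolates the sequent `Γ₁, Γ₂ ⊢ C` split into `Γ₁` and `Γ₂ ⊢ C`. -/
structure Interpolates (Γ₁ Γ₂ : Set Fml0) (C X : Fml0) : Prop where
  left_vars : X.vars ⊆ ctxVars Γ₁
  right_vars : X.vars ⊆ ctxVars Γ₂ ∪ C.vars
  left : Ded Γ₁ X
  right : Ded (insert X Γ₂) C

namespace Interpolates

variable {Γ₁ Γ₂ Δ₁ Δ₂ : Set Fml0} {A B C D X Y : Fml0}

theorem top (h : Ded Γ₂ C) : Interpolates Γ₁ Γ₂ C .top :=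
  ⟨Set.empty_subset _, Set.empty_subset _, .topI, h.mono (Set.subset_insert _ _)⟩

/-- Replace the contexts by contexts that prove them. -/
theorem of_ded (h : Interpolates Δ₁ Δ₂ C X) (hv₁ : ctxVars Δ₁ ⊆ ctxVars Γ₁)
    (hv₂ : ctxVars Δ₂ ⊆ ctxVars Γ₂) (h₁ : ∀ A ∈ Δ₁, Ded Γ₁ A) (h₂ : ∀ A ∈ Δ₂, Ded Γ₂ A) :
    Interpolates Γ₁ Γ₂ C X where
  left_vars := h.left_vars.trans hv₁
  right_vars := h.right_vars.trans (Set.union_subset_union_left _ hv₂)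
  left := h.left.trans h₁
  right := h.right.trans (by
    rintro A (rfl | hA)
    · exact .hyp (by simp)
    · exact (h₂ A hA).mono (Set.subset_insert _ _))

theorem of_insert_left (h : Interpolates (insert A Γ₁) Γ₂ C X) (hv : A.vars ⊆ ctxVars Γ₁)
    (hA : Ded Γ₁ A) : Interpolates Γ₁ Γ₂ C X :=
  h.of_ded (by simp [ctxVars_insert, hv]) subset_rfl
    (by rintro B (rfl | hB); exacts [hA, .hyp hB]) (fun _ => .hyp)

theorem of_insert_right (h : Interpolates Γ₁ (insert A Γ₂) C X) (hv : A.vars ⊆ ctxVars Γ₂)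
    (hA : Ded Γ₂ A) : Interpolates Γ₁ Γ₂ C X :=
  h.of_ded subset_rfl (by simp [ctxVars_insert, hv]) (fun _ => .hyp)
    (by rintro B (rfl | hB); exacts [hA, .hyp hB])

/-- Change the succedent. -/
theorem succedent (h : Interpolates Γ₁ Γ₂ C X) (hv : C.vars ⊆ D.vars)
    (hD : ∀ Γ, Ded Γ C → Ded Γ D) : Interpolates Γ₁ Γ₂ D X :=
  ⟨h.left_vars, h.right_vars.trans (Set.union_subset_union_right _ hv), h.left, hD _ h.right⟩

/-- Combine interpolants by conjunction. -/
theorem conj (h₁ : Interpolates Γ₁ Γ₂ A X) (h₂ : Interpolates Γ₁ Γ₂ B Y)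
    (hA : A.vars ⊆ D.vars) (hB : B.vars ⊆ D.vars)
    (hD : ∀ Γ, Ded Γ A → Ded Γ B → Ded Γ D) : Interpolates Γ₁ Γ₂ D (X.and Y) where
  left_vars := Set.union_subset h₁.left_vars h₂.left_vars
  right_vars := Set.union_subset
    (h₁.right_vars.trans (Set.union_subset_union_right _ hA))
    (h₂.right_vars.trans (Set.union_subset_union_right _ hB))
  left := .andI h₁.left h₂.left
  right := by
    have hXY : Ded (insert (X.and Y) Γ₂) (X.and Y) := .hyp (by simp)
    have hsub := Set.insert_subset_insert (a := X) (Set.subset_insert (X.and Y) Γ₂)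
    have hsub' := Set.insert_subset_insert (a := Y) (Set.subset_insert (X.and Y) Γ₂)
    exact hD _ (.cut hXY.andE1 (h₁.right.mono hsub)) (.cut hXY.andE2 (h₂.right.mono hsub'))

/-- An assumption of the left part that is the succedent is an interpolant. -/
theorem of_mem (h : C ∈ Γ₁) : Interpolates Γ₁ Γ₂ C C :=
  ⟨vars_subset_ctxVars h, Set.subset_union_right, .hyp h, .hyp (by simp)⟩

/-- Combine interpolants along a disjunction in the left part. -/
theorem disj (h₁ : Interpolates (insert A Γ₁) Γ₂ C X) (h₂ : Interpolates (insert B Γ₁) Γ₂ C Y)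
    (h : A.or B ∈ Γ₁) : Interpolates Γ₁ Γ₂ C (X.or Y) where
  left_vars := by
    have hv : A.vars ∪ B.vars ⊆ ctxVars Γ₁ := vars_subset_ctxVars h
    have hX := h₁.left_vars
    have hY := h₂.left_vars
    rw [ctxVars_insert] at hX hY
    rw [Set.union_subset_iff] at hv
    exact Set.union_subset (hX.trans (Set.union_subset hv.1 subset_rfl))
      (hY.trans (Set.union_subset hv.2 subset_rfl))
  right_vars := Set.union_subset h₁.right_vars h₂.right_vars
  left := .orE (.hyp h) (.orI1 h₁.left) (.orI2 h₂.left)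
  right := .orE (.hyp (by simp))
    (h₁.right.mono (Set.insert_subset_insert (Set.subset_insert _ _)))
    (h₂.right.mono (Set.insert_subset_insert (Set.subset_insert _ _)))

/-- Combine interpolants along a disjunction in the right part. -/
theorem conj_of_or (h₁ : Interpolates Γ₁ (insert A Γ₂) C X)
    (h₂ : Interpolates Γ₁ (insert B Γ₂) C Y) (h : A.or B ∈ Γ₂) :
    Interpolates Γ₁ Γ₂ C (X.and Y) where
  left_vars := Set.union_subset h₁.left_vars h₂.left_vars
  right_vars := by
    have hv : A.vars ∪ B.vars ⊆ ctxVars Γ₂ := vars_subset_ctxVars h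
    have hX := h₁.right_vars
    have hY := h₂.right_vars
    rw [ctxVars_insert] at hX hY
    rw [Set.union_subset_iff] at hv
    refine Set.union_subset (hX.trans ?_) (hY.trans ?_) <;> gcongr
    · exact Set.union_subset hv.1 subset_rfl
    · exact Set.union_subset hv.2 subset_rfl
  left := .andI h₁.left h₂.left
  right := by
    refine .orE (.hyp (Set.mem_insert_of_mem _ h)) (h₁.right.trans ?_) (h₂.right.trans ?_)
    · rintro D (rfl | rfl | hD)
      exacts [.andE1 (B := Y) (.hyp (by simp)), .hyp (by simp), .hyp (by simp [hD])]
    · rintro D (rfl | rfl | hD)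
      exacts [.andE2 (A := X) (.hyp (by simp)), .hyp (by simp), .hyp (by simp [hD])]

theorem impR (h : Interpolates Γ₁ (insert A Γ₂) B X) : Interpolates Γ₁ Γ₂ (A.imp B) X where
  left_vars := h.left_vars
  right_vars := by
    have hX := h.right_vars
    rw [ctxVars_insert] at hX
    refine hX.trans ?_
    rintro n ((hn | hn) | hn)
    exacts [.inr (.inl hn), .inl hn, .inr (.inr hn)]
  left := h.left
  right := .impI (by rw [Set.insert_comm]; exact h.right)

/-- Combine interpolants along an implication in the left part: here the roles of the two parts
are exchanged in the premise that proves the antecedent. -/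
theorem imp (h₁ : Interpolates Γ₂ Γ₁ A X) (h₂ : Interpolates (insert B Γ₁) Γ₂ C Y)
    (h : A.imp B ∈ Γ₁) : Interpolates Γ₁ Γ₂ C (X.imp Y) where
  left_vars := by
    have hv : A.vars ∪ B.vars ⊆ ctxVars Γ₁ := vars_subset_ctxVars h
    have hY := h₂.left_vars
    rw [ctxVars_insert] at hY
    rw [Set.union_subset_iff] at hv
    exact Set.union_subset (h₁.right_vars.trans (Set.union_subset subset_rfl hv.1))
      (hY.trans (Set.union_subset hv.2 subset_rfl))
  right_vars := Set.union_subset (h₁.left_vars.trans Set.subset_union_left) h₂.right_vars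
  left := .impI (.cut (.mp (.hyp (Set.mem_insert_of_mem _ h)) h₁.right)
    (h₂.left.mono (Set.insert_subset_insert (Set.subset_insert _ _))))
  right := .cut (.mp (.hyp (by simp)) (h₁.left.mono (Set.subset_insert _ _)))
    (h₂.right.mono (Set.insert_subset_insert (Set.subset_insert _ _)))

/-- Combine interpolants along an implication in the right part. -/
theorem conj_of_imp (h₁ : Interpolates Γ₁ Γ₂ A X) (h₂ : Interpolates Γ₁ (insert B Γ₂) C Y)
    (h : A.imp B ∈ Γ₂) : Interpolates Γ₁ Γ₂ C (X.and Y) where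
  left_vars := Set.union_subset h₁.left_vars h₂.left_vars
  right_vars := by
    have hv : A.vars ∪ B.vars ⊆ ctxVars Γ₂ := vars_subset_ctxVars h
    have hY := h₂.right_vars
    rw [ctxVars_insert] at hY
    rw [Set.union_subset_iff] at hv
    refine Set.union_subset (h₁.right_vars.trans ?_) (hY.trans ?_)
    · exact (Set.union_subset subset_rfl hv.1).trans Set.subset_union_left
    · gcongr
      exact Set.union_subset hv.2 subset_rfl
  left := .andI h₁.left h₂.left
  right := by
    have hXY : Ded (insert (X.and Y) Γ₂) (X.and Y) := .hyp (by simp)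
    have hA : Ded (insert (X.and Y) Γ₂) A :=
      .cut hXY.andE1 (h₁.right.mono (Set.insert_subset_insert (Set.subset_insert _ _)))
    refine .cut (.mp (.hyp (Set.mem_insert_of_mem _ h)) hA) (h₂.right.trans ?_)
    rintro D (rfl | rfl | hD)
    exacts [.andE2 (A := X) (.hyp (by simp)), .hyp (by simp), .hyp (by simp [hD])]

end Interpolates

/-- Maehara's lemma: every derivable sequent, however its antecedent is split, has an
interpolant. -/
theorem Der.exists_interpolates {Γ : Set Fml0} {C : Fml0} (h : Der Γ C) :
    ∀ Γ₁ Γ₂ : Set Fml0, Γ ⊆ Γ₁ ∪ Γ₂ → ∃ X, Interpolates Γ₁ Γ₂ C X := by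
  have left : ∀ {A : Fml0} {Γ Γ₁ Γ₂ : Set Fml0}, Γ ⊆ Γ₁ ∪ Γ₂ → insert A Γ ⊆ insert A Γ₁ ∪ Γ₂ :=
    fun h => by rw [Set.insert_union]; exact Set.insert_subset_insert h
  have right : ∀ {A : Fml0} {Γ Γ₁ Γ₂ : Set Fml0}, Γ ⊆ Γ₁ ∪ Γ₂ → insert A Γ ⊆ Γ₁ ∪ insert A Γ₂ :=
    fun h => by rw [Set.union_insert]; exact Set.insert_subset_insert h
  induction h with
  | ax h =>
    intro Γ₁ Γ₂ hΓ
    rcases hΓ h with h | h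
    · exact ⟨_, .of_mem h⟩
    · exact ⟨_, .top (.hyp h)⟩
  | botL h =>
    intro Γ₁ Γ₂ hΓ
    rcases hΓ h with h | h
    · exact ⟨.bot, Set.empty_subset _, Set.empty_subset _, .hyp h, .botE (.hyp (by simp))⟩
    · exact ⟨_, .top (.botE (.hyp h))⟩
  | topR => exact fun Γ₁ Γ₂ _ => ⟨_, .top .topI⟩
  | andR _ _ ih₁ ih₂ =>
    intro Γ₁ Γ₂ hΓ
    obtain ⟨X, hX⟩ := ih₁ Γ₁ Γ₂ hΓ
    obtain ⟨Y, hY⟩ := ih₂ Γ₁ Γ₂ hΓ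
    exact ⟨_, hX.conj hY Set.subset_union_left Set.subset_union_right fun _ => .andI⟩
  | @andL Γ A B C h _ ih =>
    intro Γ₁ Γ₂ hΓ
    rcases hΓ h with h | h
    all_goals
      have hv := vars_subset_ctxVars h
      rw [Fml0.vars, Set.union_subset_iff] at hv
    · obtain ⟨X, hX⟩ := ih _ _ (left (left hΓ))
      exact ⟨X, (hX.of_insert_left (by simp [ctxVars_insert, Set.subset_union_of_subset_right, hv])
        (.andE1 (B := B) (.hyp (by simp [h])))).of_insert_left hv.2 (.andE2 (.hyp h))⟩
    · obtain ⟨X, hX⟩ := ih _ _ (right (right hΓ))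
      exact ⟨X, (hX.of_insert_right (by simp [ctxVars_insert, Set.subset_union_of_subset_right, hv])
        (.andE1 (B := B) (.hyp (by simp [h])))).of_insert_right hv.2 (.andE2 (.hyp h))⟩
  | orR1 _ ih =>
    intro Γ₁ Γ₂ hΓ
    obtain ⟨X, hX⟩ := ih Γ₁ Γ₂ hΓ
    exact ⟨X, hX.succedent Set.subset_union_left fun _ => .orI1⟩
  | orR2 _ ih =>
    intro Γ₁ Γ₂ hΓ
    obtain ⟨X, hX⟩ := ih Γ₁ Γ₂ hΓ
    exact ⟨X, hX.succedent Set.subset_union_right fun _ => .orI2⟩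
  | orL h _ _ ih₁ ih₂ =>
    intro Γ₁ Γ₂ hΓ
    rcases hΓ h with h | h
    · obtain ⟨X, hX⟩ := ih₁ _ _ (left hΓ)
      obtain ⟨Y, hY⟩ := ih₂ _ _ (left hΓ)
      exact ⟨_, hX.disj hY h⟩
    · obtain ⟨X, hX⟩ := ih₁ _ _ (right hΓ)
      obtain ⟨Y, hY⟩ := ih₂ _ _ (right hΓ)
      exact ⟨_, hX.conj_of_or hY h⟩
  | impR _ ih =>
    intro Γ₁ Γ₂ hΓ
    obtain ⟨X, hX⟩ := ih _ _ (right hΓ)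
    exact ⟨X, hX.impR⟩
  | impL h _ _ ih₁ ih₂ =>
    intro Γ₁ Γ₂ hΓ
    rcases hΓ h with h | h
    · obtain ⟨X, hX⟩ := ih₁ Γ₂ Γ₁ (by rwa [Set.union_comm])
      obtain ⟨Y, hY⟩ := ih₂ _ _ (left hΓ)
      exact ⟨_, hX.imp hY h⟩
    · obtain ⟨X, hX⟩ := ih₁ Γ₁ Γ₂ hΓ
      obtain ⟨Y, hY⟩ := ih₂ _ _ (right hΓ)
      exact ⟨_, hX.conj_of_imp hY h⟩
  | @boxL Γ A C h _ ih =>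
    intro Γ₁ Γ₂ hΓ
    rcases hΓ h with h | h
    · obtain ⟨X, hX⟩ := ih _ _ (left hΓ)
      exact ⟨X, hX.of_insert_left (vars_subset_ctxVars (A := A.box) h) (.boxE (.hyp h))⟩
    · obtain ⟨X, hX⟩ := ih _ _ (right hΓ)
      exact ⟨X, hX.of_insert_right (vars_subset_ctxVars (A := A.box) h) (.boxE (.hyp h))⟩
  | @boxAndL Γ A B C h _ ih =>
    intro Γ₁ Γ₂ hΓ
    rcases hΓ h with h | h
    all_goals
      have hv := vars_subset_ctxVars h
      rw [Fml0.vars, Fml0.vars, Set.union_subset_iff] at hv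
      have hAB := Ded.boxAndE (.hyp h)
    · obtain ⟨X, hX⟩ := ih _ _ (left (left hΓ))
      exact ⟨X, (hX.of_insert_left (A := A.box)
        (by simp [Fml0.vars, ctxVars_insert, Set.subset_union_of_subset_right, hv])
        (hAB.andE1.mono (Set.subset_insert _ _))).of_insert_left hv.2 hAB.andE2⟩
    · obtain ⟨X, hX⟩ := ih _ _ (right (right hΓ))
      exact ⟨X, (hX.of_insert_right (A := A.box)
        (by simp [Fml0.vars, ctxVars_insert, Set.subset_union_of_subset_right, hv])
        (hAB.andE1.mono (Set.subset_insert _ _))).of_insert_right hv.2 hAB.andE2⟩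
  | boxAx h =>
    intro Γ₁ Γ₂ hΓ
    rcases hΓ h with h | h
    · exact ⟨_, .of_mem h⟩
    · exact ⟨_, .top (.hyp h)⟩
  | boxAndR _ _ ih₁ ih₂ =>
    intro Γ₁ Γ₂ hΓ
    obtain ⟨X, hX⟩ := ih₁ Γ₁ Γ₂ hΓ
    obtain ⟨Y, hY⟩ := ih₂ Γ₁ Γ₂ hΓ
    exact ⟨_, hX.conj hY Set.subset_union_left Set.subset_union_right fun _ => .boxAndI⟩
  | boxBoxR _ ih =>
    intro Γ₁ Γ₂ hΓ
    obtain ⟨X, hX⟩ := ih Γ₁ Γ₂ hΓ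
    exact ⟨X, hX.succedent subset_rfl fun _ => .boxFour⟩
  | nec h _ => exact fun Γ₁ Γ₂ _ => ⟨_, .top (Der.nec h).ded⟩

/-- the logic iS4 = iK ⊕ (□p → p) ⊕ (□p → □□p) has the Craig
interpolation property. -/
theorem iS4_CIP : CIP0 (smallestBoxLogic {axT0, axFour0}) := by
  intro φ ψ h
  obtain ⟨χ, hχ⟩ := (der_of_imp_mem_iS4 h).exists_interpolates {φ} ∅ (by simp)
  have hφ := hχ.left_vars
  have hψ := hχ.right_vars
  simp only [ctxVars, Set.biUnion_singleton, Set.biUnion_empty, Set.empty_union] at hφ hψ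
  refine ⟨χ, Set.subset_inter hφ hψ, ?_, hχ.right.impI.mem_iS4⟩
  exact Ded.mem_iS4 (.impI (hχ.left.mono (by simp)))
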